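/- Let n ≥ 1, R > 0 and 0 < t₁ < t₂. Then there exists a constant C > 0, depending only on n, R, t₁ and t₂, such that for every integrable u₀ : ℝⁿ → ℝ with u₀ ≥ 0 and support contained in the closed ball of radius R centered at the origin, the heat extension u of u₀ satisfies ‖u₀‖_{L¹(ℝⁿ)} ≤ C · ( ∫_{t₁}^{t₂} ∫_{‖y‖ < 2R} |u(y,t)|² dy dt )^{1/2}. -/

import Mathlib

open MeasureTheory Real

/-- The heat extension of an initial datum `u₀ : ℝⁿ → ℝ`:
`u(y,t) = (4πt)^(-n/2) ∫ u₀(r) exp(-‖y-r‖²/(4t)) dr`. -/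
noncomputable def heatExt (n : ℕ) (u₀ : EuclideanSpace ℝ (Fin n) → ℝ)
    (y : EuclideanSpace ℝ (Fin n)) (t : ℝ) : ℝ :=
  (4 * π * t) ^ (-(n : ℝ) / 2) * ∫ r, u₀ r * Real.exp (-‖y - r‖ ^ 2 / (4 * t))

theorem heatExt_sm (n : ℕ) (u₀ : EuclideanSpace ℝ (Fin n) → ℝ) (hu : Integrable u₀) :
    StronglyMeasurable (fun p : ℝ × EuclideanSpace ℝ (Fin n) => heatExt n u₀ p.2 p.1) := by
  obtain ⟨v, hv, huv⟩ := hu.1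
  have h1 : ∀ y t, heatExt n u₀ y t = heatExt n v y t := by
    intro y t
    unfold heatExt
    congr 1
    apply integral_congr_ae
    filter_upwards [huv] with r hr
    rw [hr]
  simp_rw [h1]
  unfold heatExt
  apply StronglyMeasurable.mul
  · apply Measurable.stronglyMeasurable
    fun_prop
  · have hm : StronglyMeasurable (fun q : (ℝ × EuclideanSpace ℝ (Fin n)) × EuclideanSpace ℝ (Fin n) =>
        v q.2 * Real.exp (-‖q.1.2 - q.2‖ ^ 2 / (4 * q.1.1))) := by
      apply Measurable.stronglyMeasurable
      have := hv.measurable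
      fun_prop
    exact hm.integral_prod_right'

theorem heatExt_bounds (n : ℕ) (R t₁ t₂ : ℝ)
    (hR : 0 < R) (ht₁ : 0 < t₁) (u₀ : EuclideanSpace ℝ (Fin n) → ℝ)
    (hu : Integrable u₀) (h0 : ∀ y, 0 ≤ u₀ y)
    (hs : Function.support u₀ ⊆ Metric.closedBall 0 R)
    (t : ℝ) (ht : t ∈ Set.Ioo t₁ t₂) (y : EuclideanSpace ℝ (Fin n))
    (hy : y ∈ Metric.ball (0 : EuclideanSpace ℝ (Fin n)) (2 * R)) :
    (4 * π * t₂) ^ (-(n : ℝ) / 2) * Real.exp (-(3 * R) ^ 2 / (4 * t₁)) * (∫ r, u₀ r)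
      ≤ heatExt n u₀ y t ∧ heatExt n u₀ y t ≤ (4 * π * t₁) ^ (-(n : ℝ) / 2) * ∫ r, u₀ r := by
  obtain ⟨hta, htb⟩ := ht
  have htp : 0 < t := ht₁.trans hta
  have hpi := Real.pi_pos
  have hM : 0 ≤ ∫ r, u₀ r := integral_nonneg h0
  have hle1 : ∀ r, Real.exp (-‖y - r‖ ^ 2 / (4 * t)) ≤ 1 := by
    intro r
    rw [Real.exp_le_one_iff]
    apply div_nonpos_of_nonpos_of_nonneg <;> nlinarith [sq_nonneg ‖y - r‖]
  have hint : Integrable (fun r => u₀ r * Real.exp (-‖y - r‖ ^ 2 / (4 * t))) := by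
    refine hu.mul_bdd (c := 1) ?_ ?_
    · apply Continuous.aestronglyMeasurable
      fun_prop
    · filter_upwards with r
      rw [Real.norm_eq_abs, abs_of_pos (Real.exp_pos _)]
      exact hle1 r
  have hn0 : -(n : ℝ) / 2 ≤ 0 := by
    have : (0:ℝ) ≤ n := Nat.cast_nonneg n
    linarith
  have hlow : Real.exp (-(3 * R) ^ 2 / (4 * t₁)) * (∫ r, u₀ r)
      ≤ ∫ r, u₀ r * Real.exp (-‖y - r‖ ^ 2 / (4 * t)) := by
    rw [mul_comm, ← integral_mul_const]
    apply integral_mono (hu.mul_const _) hint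
    intro r
    by_cases hr : u₀ r = 0
    · simp [hr]
    · have hr' : r ∈ Metric.closedBall 0 R := hs hr
      rw [mem_closedBall_zero_iff] at hr'
      rw [mem_ball_zero_iff] at hy
      have h3 : ‖y - r‖ ≤ 3 * R := (norm_sub_le _ _).trans (by linarith)
      have h4 : ‖y - r‖ ^ 2 ≤ (3 * R) ^ 2 := by gcongr
      apply mul_le_mul_of_nonneg_left _ (h0 r)
      apply Real.exp_le_exp.mpr
      rw [neg_div, neg_div]
      apply neg_le_neg
      gcongr
  have hup : (∫ r, u₀ r * Real.exp (-‖y - r‖ ^ 2 / (4 * t))) ≤ ∫ r, u₀ r :=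
    integral_mono hint hu fun r => mul_le_of_le_one_right (h0 r) (hle1 r)
  have hc1 : (4 * π * t₂) ^ (-(n : ℝ) / 2) ≤ (4 * π * t) ^ (-(n : ℝ) / 2) :=
    Real.rpow_le_rpow_of_nonpos (by positivity) (by gcongr) hn0
  have hc2 : (4 * π * t) ^ (-(n : ℝ) / 2) ≤ (4 * π * t₁) ^ (-(n : ℝ) / 2) :=
    Real.rpow_le_rpow_of_nonpos (by positivity) (by gcongr) hn0
  unfold heatExt
  constructor
  · rw [mul_assoc]
    exact mul_le_mul hc1 hlow (by positivity) (by positivity)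
  · exact mul_le_mul hc2 hup (le_trans (by positivity) hlow) (by positivity)

/-- For nonnegative integrable initial temperatures supported in the ball of radius `R`,
the `L¹` norm of `u₀` is controlled, uniformly in `u₀`, by the `L²` norm of its heat
extension on `2B × (t₁,t₂)`. -/
theorem lipschitz_stability_nonneg_time_interval (n : ℕ) (hn : 1 ≤ n) (R t₁ t₂ : ℝ)
    (hR : 0 < R) (ht₁ : 0 < t₁) (ht₁₂ : t₁ < t₂) :
    ∃ C > 0, ∀ u₀ : EuclideanSpace ℝ (Fin n) → ℝ,
      Integrable u₀ →
      (∀ y, 0 ≤ u₀ y) →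
      Function.support u₀ ⊆ Metric.closedBall 0 R →
      (∫ y, |u₀ y|) ≤
        C * (∫ t in Set.Ioo t₁ t₂,
              ∫ y in Metric.ball (0 : EuclideanSpace ℝ (Fin n)) (2 * R),
                (heatExt n u₀ y t) ^ 2) ^ ((1 : ℝ) / 2) := by
  have hpi := Real.pi_pos
  have ht₂ : 0 < t₂ := ht₁.trans ht₁₂
  set B := Metric.ball (0 : EuclideanSpace ℝ (Fin n)) (2 * R) with hB
  set c := (4 * π * t₂) ^ (-(n : ℝ) / 2) * Real.exp (-(3 * R) ^ 2 / (4 * t₁)) with hc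
  set d := (4 * π * t₁) ^ (-(n : ℝ) / 2) with hd
  have hcp : 0 < c := by positivity
  have hdp : 0 < d := by positivity
  have hBfin : volume B ≠ ⊤ := measure_ball_lt_top.ne
  set V := volume.real B with hV
  have hVp : 0 < V :=
    ENNReal.toReal_pos (Metric.measure_ball_pos _ _ (by positivity)).ne' hBfin
  have hW : 0 < V * (t₂ - t₁) := mul_pos hVp (by linarith)
  refine ⟨(c * √(V * (t₂ - t₁)))⁻¹, by positivity, ?_⟩
  intro u₀ hu h0 hs
  have hbd := heatExt_bounds n R t₁ t₂ hR ht₁ u₀ hu h0 hs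
  have hsm := heatExt_sm n u₀ hu
  have habs : (∫ y, |u₀ y|) = ∫ y, u₀ y := by
    congr 1; ext y; exact abs_of_nonneg (h0 y)
  rw [habs]
  set M := ∫ y, u₀ y with hMdef
  have hM : 0 ≤ M := integral_nonneg h0
  have hsq : ∀ t ∈ Set.Ioo t₁ t₂, ∀ y ∈ B,
      (c * M) ^ 2 ≤ heatExt n u₀ y t ^ 2 ∧ heatExt n u₀ y t ^ 2 ≤ (d * M) ^ 2 := by
    intro t ht y hy
    obtain ⟨h1, h2⟩ := hbd t ht y hy
    have hp : 0 ≤ c * M := by positivity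
    exact ⟨pow_le_pow_left₀ hp h1 2, pow_le_pow_left₀ (hp.trans h1) h2 2⟩
  have hinner : ∀ t ∈ Set.Ioo t₁ t₂, IntegrableOn (fun y => heatExt n u₀ y t ^ 2) B := by
    intro t ht
    refine Measure.integrableOn_of_bounded (M := (d * M) ^ 2) hBfin ?_ ?_
    · exact ((hsm.comp_measurable (measurable_prodMk_left (x := t))).pow 2).aestronglyMeasurable
    · filter_upwards [ae_restrict_mem measurableSet_ball] with y hy
      rw [Real.norm_eq_abs, abs_of_nonneg (sq_nonneg _)]
      exact (hsq t ht y hy).2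
  have hin : ∀ t ∈ Set.Ioo t₁ t₂, V * (c * M) ^ 2 ≤ ∫ y in B, heatExt n u₀ y t ^ 2 ∧
      (∫ y in B, heatExt n u₀ y t ^ 2) ≤ V * (d * M) ^ 2 := by
    intro t ht
    constructor
    · have := setIntegral_mono_on (integrableOn_const (C := (c * M) ^ 2) hBfin) (hinner t ht)
        measurableSet_ball (fun y hy => (hsq t ht y hy).1)
      rwa [setIntegral_const, smul_eq_mul] at this
    · have := setIntegral_mono_on (hinner t ht) (integrableOn_const (C := (d * M) ^ 2) hBfin)
        measurableSet_ball (fun y hy => (hsq t ht y hy).2)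
      rwa [setIntegral_const, smul_eq_mul] at this
  have hIfin : volume (Set.Ioo t₁ t₂) ≠ ⊤ := measure_Ioo_lt_top.ne
  have houter : IntegrableOn (fun t => ∫ y in B, heatExt n u₀ y t ^ 2) (Set.Ioo t₁ t₂) := by
    refine Measure.integrableOn_of_bounded (M := V * (d * M) ^ 2) hIfin ?_ ?_
    · exact (hsm.pow 2).integral_prod_right'.aestronglyMeasurable
    · filter_upwards [ae_restrict_mem measurableSet_Ioo] with t ht
      rw [Real.norm_eq_abs, abs_of_nonneg (integral_nonneg fun _ => sq_nonneg _)]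
      exact (hin t ht).2
  have hfin := setIntegral_mono_on (integrableOn_const (C := V * (c * M) ^ 2) hIfin) houter
        measurableSet_Ioo (fun t ht => (hin t ht).1)
  rw [setIntegral_const, smul_eq_mul, Real.volume_real_Ioo_of_le ht₁₂.le] at hfin
  rw [← Real.sqrt_eq_rpow, ← div_eq_inv_mul, le_div_iff₀ (by positivity)]
  apply Real.le_sqrt_of_sq_le
  refine le_trans (le_of_eq ?_) hfin
  rw [mul_pow, mul_pow, Real.sq_sqrt hW.le]
  ring
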